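/- arXiv:math/0405072 — 2 statements merged into one kernel-verified Lean document; each statement's English description precedes it below -/
import Mathlib

section
/- Let N be a nonnegative integer, η ∈ ℂ, and a = (a₁,a₂,a₃,a₄) ∈ ℂ⁴ with a₁+a₂+a₃+a₄ = 0. Then for every f ∈ Θ_N there is a unique entire function g : ℂ → ℂ such that θ(2x)·g(x) = ∏_{i=1}^4 θ(x+a_i−Nη/2)·f(x+η) − ∏_{i=1}^4 θ(x−a_i+Nη/2)·f(x−η) for all x ∈ ℂ, and this g again belongs to Θ_N. (Thus the difference operator Δ(a) preserves Θ_N.) -/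
noncomputable section
open Complex MeasureTheory

def cπ : ℂ := Real.pi

/-- Jacobi's first theta function θ₁(x|τ). -/
def θf (τ x : ℂ) : ℂ :=
  I * ∑' n : ℤ, (-1 : ℂ) ^ n *
    Complex.exp (cπ * I * τ * ((n : ℂ) - 1/2)^2 + cπ * I * (2*(n : ℂ) - 1) * x)

/-- The space Θ_N of even theta functions of order 2N. -/
def ThetaSp (τ : ℂ) (N : ℕ) (f : ℂ → ℂ) : Prop :=
  Differentiable ℂ f ∧ (∀ x, f (x + 1) = f x) ∧
  (∀ x, f (x + τ) = Complex.exp (-2*cπ*I*N*(2*x + τ)) * f x) ∧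
  (∀ x, f (-x) = f x)

/-- Sklyanin's weight function M(u,v). -/
def Mw (τ η : ℂ) (N : ℕ) (u v : ℂ) : ℂ :=
  θf τ (2*u) * θf τ (2*v) /
    (Complex.exp (2*cπ*I*u*(N+2)) *
      ∏ k ∈ Finset.range (N+2),
        (θf τ (u + v + (2*(k:ℂ) - N - 1)*η + 1/2 + τ/2) *
         θf τ (u - v + (2*(k:ℂ) - N - 1)*η + 1/2 + τ/2)))

/-- Sklyanin's invariant pairing, with τ = t * I. -/
def pairing (τ η : ℂ) (t : ℝ) (N : ℕ) (f g : ℂ → ℂ) : ℂ :=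
  ∫ y in (0:ℝ)..t, ∫ x in (0:ℝ)..(1:ℝ),
    f (x + y*I) * (starRingEnd ℂ) (g (x + y*I)) *
      Mw τ η N (x + y*I) ((starRingEnd ℂ) (x + y*I))

/-- The numerator defining the difference operator Δ(a). -/
def ΔRHS (τ η : ℂ) (N : ℕ) (a₁ a₂ a₃ a₄ : ℂ) (f : ℂ → ℂ) (x : ℂ) : ℂ :=
  θf τ (x + a₁ - N*η/2) * θf τ (x + a₂ - N*η/2) * θf τ (x + a₃ - N*η/2) *
    θf τ (x + a₄ - N*η/2) * f (x + η)
  - θf τ (x - a₁ + N*η/2) * θf τ (x - a₂ + N*η/2) * θf τ (x - a₃ + N*η/2) *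
    θf τ (x - a₄ + N*η/2) * f (x - η)

/-- The involution σ on Θ_N. -/
def σop (τ : ℂ) (N : ℕ) (f : ℂ → ℂ) (x : ℂ) : ℂ :=
  Complex.exp (2*cπ*I*N*(1/4 + τ/4 + x)) * f (x + 1/2 + τ/2)

/-- q-Pochhammer infinite product (a;p)_∞. -/
def qPoch (a p : ℂ) : ℂ := ∏' j : ℕ, (1 - a * p^j)

/-- The constant C of Theorem 3.2. -/
def Cconst (τ η : ℂ) (N : ℕ) : ℂ :=
  2*η * Complex.exp (2*cπ*I*τ*(3/8)) /
    (θf τ (2*(N+1)*η) *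
      (qPoch (Complex.exp (2*cπ*I*τ)) (Complex.exp (2*cπ*I*τ)))^3)

/-- The kernel K(u,w). -/
def Kk (τ η : ℂ) (N : ℕ) (u w : ℂ) : ℂ :=
  Complex.exp (2*cπ*I*u*(N:ℂ)) *
  ∏ k ∈ Finset.range N,
    (θf τ (u + w + (2*(k:ℂ) - N + 1)*η + 1/2 + τ/2) *
     θf τ (u - w + (2*(k:ℂ) - N + 1)*η + 1/2 + τ/2))

/-- The basis functions e_k^N(x;a,b). -/
def ekN (τ η : ℂ) (N k : ℕ) (a b : ℂ) (x : ℂ) : ℂ :=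
  (∏ j ∈ Finset.range k, (θf τ (a + x + 2*(j:ℂ)*η) * θf τ (a - x + 2*(j:ℂ)*η))) *
  (∏ j ∈ Finset.range (N - k), (θf τ (b + x + 2*(j:ℂ)*η) * θf τ (b - x + 2*(j:ℂ)*η)))

/-- Elliptic number [x] = θ(2ηx). -/
def ell (τ η x : ℂ) : ℂ := θf τ (2*η*x)

/-- Elliptic shifted factorial [x]_k. -/
def ellFac (τ η x : ℂ) (k : ℕ) : ℂ := ∏ j ∈ Finset.range k, ell τ η (x + j)


/-- Division of entire functions with simple zeros in the denominator. -/
lemma exists_div_entire (D H : ℂ → ℂ) (hD : Differentiable ℂ D) (hH : Differentiable ℂ H)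
    (h : ∀ x, D x = 0 → deriv D x ≠ 0 ∧ H x = 0) :
    ∃ g : ℂ → ℂ, Differentiable ℂ g ∧ ∀ x, D x * g x = H x := by
  classical
  refine ⟨fun x => if D x = 0 then deriv H x / deriv D x else H x / D x, ?_, ?_⟩
  · intro x₀
    by_cases h0 : D x₀ = 0
    · obtain ⟨hd, hh⟩ := h x₀ h0
      have dD : Differentiable ℂ (dslope D x₀) := by
        rw [← differentiableOn_univ]
        exact (Complex.differentiableOn_dslope Filter.univ_mem).2 hD.differentiableOn
      have dH : Differentiable ℂ (dslope H x₀) := by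
        rw [← differentiableOn_univ]
        exact (Complex.differentiableOn_dslope Filter.univ_mem).2 hH.differentiableOn
      have hne : dslope D x₀ x₀ ≠ 0 := by rwa [dslope_same]
      have key : DifferentiableAt ℂ (fun x => dslope H x₀ x / dslope D x₀ x) x₀ :=
        (dH x₀).fun_div (dD x₀) hne
      refine key.congr_of_eventuallyEq ?_
      filter_upwards [(dD x₀).continuousAt.eventually_ne hne] with x hx
      by_cases hxx : x = x₀
      · subst hxx
        simp [h0, dslope_same]
      · have e1 : D x = (x - x₀) * dslope D x₀ x := by
          have := sub_smul_dslope D x₀ x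
          simp only [smul_eq_mul, h0, sub_zero] at this
          exact this.symm
        have e2 : H x = (x - x₀) * dslope H x₀ x := by
          have := sub_smul_dslope H x₀ x
          simp only [smul_eq_mul, hh, sub_zero] at this
          exact this.symm
        have hs : x - x₀ ≠ 0 := sub_ne_zero.2 hxx
        have hDx : D x ≠ 0 := by rw [e1]; exact mul_ne_zero hs hx
        rw [if_neg hDx, e1, e2, mul_div_mul_left _ _ hs]
    · refine ((hH x₀).fun_div (hD x₀) h0).congr_of_eventuallyEq ?_
      filter_upwards [(hD x₀).continuousAt.eventually_ne h0] with x hx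
      simp [hx]
  · intro x
    by_cases h0 : D x = 0
    · simp [h0, (h x h0).2]
    · simp only [h0, if_false]
      field_simp

lemma cancel_entire (D u v : ℂ → ℂ) (hD : Differentiable ℂ D) (hu : Differentiable ℂ u)
    (hv : Differentiable ℂ v) (h : ∀ x, D x = 0 → deriv D x ≠ 0)
    (huv : ∀ x, D x * u x = D x * v x) (x : ℂ) : u x = v x := by
  by_cases h0 : D x = 0
  · have h1 := ((hD x).hasDerivAt).fun_mul (hu x).hasDerivAt
    have h2 := ((hD x).hasDerivAt).fun_mul (hv x).hasDerivAt
    have : (fun y => D y * u y) = fun y => D y * v y := funext huv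
    rw [this] at h1
    have h3 := h1.unique h2
    rw [h0] at h3
    simp only [zero_mul, add_zero] at h3
    exact mul_left_cancel₀ (h x h0) h3
  · exact mul_left_cancel₀ h0 (huv x)

/-- Reduction to the fundamental rectangle. -/
lemma box_induction (t : ℝ) (ht : 0 < t) (τ : ℂ) (hτ : τ = t * I) (S : ℂ → Prop)
    (h1 : ∀ x, S x ↔ S (x + 1)) (h2 : ∀ x, S x ↔ S (x + τ))
    (hb : ∀ x : ℂ, 0 ≤ x.re → x.re < 1 → 0 ≤ x.im → x.im < t → S x) (x : ℂ) : S x := by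
  have a1 : ∀ (n : ℤ) x, S x ↔ S (x + n) := by
    intro n
    induction n using Int.induction_on with
    | zero => simp
    | succ n ih =>
      intro x
      rw [ih x, h1 (x + _)]
      push_cast
      rw [add_assoc]
    | pred n ih =>
      intro x
      rw [ih x, h1 (x + ((-(n:ℤ) - 1 : ℤ) : ℂ))]
      push_cast
      ring_nf
  have a2 : ∀ (n : ℤ) x, S x ↔ S (x + n * τ) := by
    intro n
    induction n using Int.induction_on with
    | zero => simp
    | succ n ih =>
      intro x
      rw [ih x, h2 (x + _)]
      push_cast
      ring_nf
    | pred n ih =>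
      intro x
      rw [ih x, h2 (x + ((-(n:ℤ) - 1 : ℤ) : ℂ) * τ)]
      push_cast
      ring_nf
  rw [a1 (-⌊x.re⌋) x, a2 (-⌊x.im / t⌋)]
  have f1 := Int.floor_le x.re
  have f2 := Int.lt_floor_add_one x.re
  have f3 := Int.floor_le (x.im / t)
  have f4 := Int.lt_floor_add_one (x.im / t)
  rw [le_div_iff₀ ht] at f3
  rw [div_lt_iff₀ ht] at f4
  apply hb <;> subst hτ <;> simp <;> linarith

/-- The product `∏ (1 - p^n z)`. -/
def qF (p z : ℂ) : ℂ := ∏' n : ℕ, (1 + -(p ^ n * z))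

lemma qF_summable (p z : ℂ) (hp : ‖p‖ < 1) : Summable fun n : ℕ => ‖-(p ^ n * z)‖ := by
  simp only [norm_neg, norm_mul, norm_pow]
  exact (summable_geometric_of_lt_one (norm_nonneg _) hp).mul_right _

lemma qF_step (p z : ℂ) (hp : ‖p‖ < 1) : qF p z = (1 - z) * qF p (p * z) := by
  unfold qF
  rw [tprod_eq_zero_mul']
  · simp only [pow_zero, one_mul, pow_succ, mul_assoc, sub_eq_add_neg]
  · have := multipliable_one_add_of_summable (qF_summable p (p * z) hp)
    simpa only [pow_succ, mul_assoc] using this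

lemma qF_ne_zero (p z : ℂ) (hp : ‖p‖ < 1) (hz : ‖z‖ < 1) : qF p z ≠ 0 := by
  refine tprod_one_add_ne_zero_of_summable (fun n hn => ?_) (qF_summable p z hp)
  have h1 : p ^ n * z = 1 := by linear_combination -hn
  have h2 : ‖p ^ n * z‖ < 1 := by
    rw [norm_mul, norm_pow]
    have := pow_le_one₀ (n := n) (norm_nonneg p) hp.le
    nlinarith [norm_nonneg z]
  rw [h1] at h2
  simp at h2

lemma qF_differentiable (p : ℂ) (hp : ‖p‖ < 1) : Differentiable ℂ (qF p) := by
  intro z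
  have hs : Summable fun n : ℕ => ‖p‖ ^ n * (‖z‖ + 1) :=
    (summable_geometric_of_lt_one (norm_nonneg _) hp).mul_right _
  have key := Summable.hasProdLocallyUniformlyOn_nat_one_add (K := Metric.ball (0:ℂ) (‖z‖ + 1))
    (f := fun n z => -(p ^ n * z)) Metric.isOpen_ball hs
    (Filter.Eventually.of_forall fun n x hx => by
      simp only [norm_neg, norm_mul, norm_pow]
      have : ‖x‖ ≤ ‖z‖ + 1 := by simpa using (mem_ball_zero_iff.1 hx).le
      gcongr) (fun n => by fun_prop)
  have hd : DifferentiableOn ℂ (fun x => ∏' n : ℕ, (1 + -(p ^ n * x)))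
      (Metric.ball (0:ℂ) (‖z‖ + 1)) :=
    key.differentiableOn (.of_forall fun _ ↦ by
      simpa [Finset.prod_fn] using DifferentiableOn.finsetProd (fun _ _ ↦ by fun_prop))
      Metric.isOpen_ball
  exact hd.differentiableAt (Metric.isOpen_ball.mem_nhds (by simp))

/-- `e(x) = exp(2πix)` -/
def ee (x : ℂ) : ℂ := Complex.exp (2 * cπ * I * x)

lemma ee_add (x y : ℂ) : ee (x + y) = ee x * ee y := by
  simp only [ee, mul_add, Complex.exp_add]

lemma ee_neg_mul (x : ℂ) : ee (-x) * ee x = 1 := by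
  rw [← ee_add]; simp [ee]

lemma ee_one : ee 1 = 1 := by
  simp only [ee, cπ, mul_one, Complex.exp_two_pi_mul_I]

lemma ee_diff : Differentiable ℂ ee := by unfold ee; fun_prop

lemma ee_norm (x : ℂ) : ‖ee x‖ = Real.exp (-2 * Real.pi * x.im) := by
  simp [ee, cπ, Complex.norm_exp]

lemma ee_ne (x : ℂ) : ee x ≠ 0 := Complex.exp_ne_zero _

lemma ee_deriv (x : ℂ) : HasDerivAt ee (2 * cπ * I * ee x) x := by
  unfold ee
  have := ((hasDerivAt_id x).const_mul (2 * cπ * I)).cexp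
  simpa [mul_comm] using this

lemma cpi_ne : cπ ≠ 0 := by simp [cπ, Real.pi_ne_zero]

def PP (τ x : ℂ) : ℂ := qF (ee τ) (ee x) * qF (ee τ) (ee τ * ee (-x))

lemma ee_tau_norm (t : ℝ) (ht : 0 < t) (τ : ℂ) (hτ : τ = t * I) : ‖ee τ‖ < 1 := by
  rw [ee_norm, Real.exp_lt_one_iff]
  subst hτ
  simp
  positivity

lemma PP_diff (τ : ℂ) (hp : ‖ee τ‖ < 1) : Differentiable ℂ (PP τ) := by
  have h1 := qF_differentiable _ hp
  have h2 := ee_diff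
  unfold PP
  fun_prop

lemma PP_add_one (τ x : ℂ) : PP τ (x + 1) = PP τ x := by
  have : ee (-(x + 1)) = ee (-x) := by
    have h := ee_add (-(x+1)) 1
    rw [ee_one] at h
    rw [show -(x+1) + 1 = -x by ring] at h
    rw [h, mul_one]
  simp only [PP, this, ee_add x 1, ee_one, mul_one]

lemma PP_add_tau (τ x : ℂ) (hp : ‖ee τ‖ < 1) : PP τ (x + τ) = -ee (-x) * PP τ x := by
  have h1 : ee τ * ee (-(x + τ)) = ee (-x) := by rw [← ee_add]; ring_nf
  have h2 := ee_neg_mul x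
  simp only [PP, h1]
  rw [qF_step _ (ee (-x)) hp, qF_step _ (ee x) hp, ee_add x τ, mul_comm (ee x) (ee τ)]
  linear_combination (-qF (ee τ) (ee τ * ee x) * qF (ee τ) (ee τ * ee (-x))) * h2

/-- Zeros of `PP` in the box. -/
lemma PP_box (t : ℝ) (ht : 0 < t) (τ : ℂ) (hτ : τ = t * I) (x : ℂ) (hx0 : 0 ≤ x.re)
    (hx1 : x.re < 1) (hy0 : 0 ≤ x.im) (hy1 : x.im < t) (hx : PP τ x = 0) :
    x = 0 ∧ deriv (PP τ) x ≠ 0 := by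
  have hp := ee_tau_norm t ht τ hτ
  have him : τ.im = t := by subst hτ; simp
  have n1 : ‖ee τ * ee x‖ < 1 := by
    rw [← ee_add, ee_norm, Real.exp_lt_one_iff, Complex.add_im, him]
    nlinarith [Real.pi_pos]
  have n2 : ‖ee τ * ee (-x)‖ < 1 := by
    rw [← ee_add, ee_norm, Real.exp_lt_one_iff, Complex.add_im, him, Complex.neg_im]
    nlinarith [Real.pi_pos]
  have g1 := qF_ne_zero _ _ hp n1
  have g2 := qF_ne_zero _ _ hp n2
  have hP : PP τ = fun x => (1 - ee x) * (qF (ee τ) (ee τ * ee x) * qF (ee τ) (ee τ * ee (-x))) := by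
    funext x
    rw [PP, qF_step _ (ee x) hp, mul_assoc]
  have he : ee x = 1 := by
    rw [hP] at hx
    have := (mul_eq_zero.1 hx).resolve_right (mul_ne_zero g1 g2)
    linear_combination -this
  constructor
  · unfold ee at he
    rw [Complex.exp_eq_one_iff] at he
    obtain ⟨n, hn⟩ := he
    have hxn : x = n := by
      have : (2 * cπ * I) * x = (2 * cπ * I) * n := by rw [hn, cπ]; ring
      exact mul_left_cancel₀ (by simp [cpi_ne]) this
    rw [hxn] at hx0 hx1
    simp only [Complex.intCast_re] at hx0 hx1
    have : n = 0 := by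
      have h1 : (0:ℤ) ≤ n := by exact_mod_cast hx0
      have h2 : n < (1:ℤ) := by exact_mod_cast hx1
      omega
    rw [hxn, this]; simp
  · have hG : DifferentiableAt ℂ
        (fun x => qF (ee τ) (ee τ * ee x) * qF (ee τ) (ee τ * ee (-x))) x := by
      have h1 := qF_differentiable _ hp
      have h2 := ee_diff
      fun_prop
    have h := ((ee_deriv x).const_sub 1).fun_mul hG.hasDerivAt
    rw [hP, h.deriv]
    have h0 : 1 - ee x = 0 := by rw [he, sub_self]
    rw [h0, zero_mul, add_zero]
    exact mul_ne_zero (neg_ne_zero.2 (mul_ne_zero (by simp [cpi_ne]) (ee_ne x)))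
      (mul_ne_zero g1 g2)

lemma deriv_zero_shift (F c : ℂ → ℂ) (s x : ℂ) (hF : Differentiable ℂ F)
    (hc : Differentiable ℂ c) (h : ∀ x, F (x + s) = c x * F x) (h0 : F x = 0) :
    deriv F (x + s) = c x * deriv F x := by
  have h1 : deriv (fun y => F (y + s)) x = deriv F (x + s) := deriv_comp_add_const F s x
  have h2 := ((hc x).hasDerivAt.fun_mul (hF x).hasDerivAt).deriv
  have h3 : (fun y => F (y + s)) = fun y => c y * F y := funext h
  rw [← h1, h3, h2, h0]
  simp

lemma theta_eq (τ x : ℂ) : θf τ x =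
    I * Complex.exp (cπ * I * τ / 4 - cπ * I * x) * jacobiTheta₂ (x - τ / 2 + 1 / 2) τ := by
  rw [θf, jacobiTheta₂, mul_assoc I (Complex.exp _)]
  congr 1
  rw [← tsum_mul_left]
  apply tsum_congr
  intro n
  have : (-1 : ℂ) ^ n = Complex.exp (n * (cπ * I)) := by
    rw [Complex.exp_int_mul, cπ, Complex.exp_pi_mul_I]
  rw [this, jacobiTheta₂_term, ← Complex.exp_add, ← Complex.exp_add]
  congr 1
  simp only [cπ]
  ring

lemma theta_diff (τ : ℂ) (h : 0 < τ.im) : Differentiable ℂ (θf τ) := by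
  have h1 : Differentiable ℂ (fun z => jacobiTheta₂ z τ) :=
    fun z => differentiableAt_jacobiTheta₂_fst z h
  rw [funext (theta_eq τ)]
  have h2 : Differentiable ℂ (fun x => jacobiTheta₂ (x - τ / 2 + 1 / 2) τ) :=
    h1.comp (f := fun x : ℂ => x - τ / 2 + 1 / 2) (by fun_prop)
  fun_prop

lemma exp_cpi : Complex.exp (cπ * I) = -1 := by simp [cπ, Complex.exp_pi_mul_I]

lemma theta_add_one (τ x : ℂ) : θf τ (x + 1) = -θf τ x := by
  rw [theta_eq, theta_eq, show x + 1 - τ / 2 + 1 / 2 = x - τ / 2 + 1 / 2 + 1 by ring,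
    jacobiTheta₂_add_left,
    show cπ * I * τ / 4 - cπ * I * (x + 1) = cπ * I * τ / 4 - cπ * I * x - cπ * I by ring,
    Complex.exp_sub _ (cπ * I), exp_cpi]
  ring

lemma theta_add_tau (τ x : ℂ) :
    θf τ (x + τ) = -Complex.exp (-cπ * I * (2 * x + τ)) * θf τ x := by
  rw [theta_eq, theta_eq, show x + τ - τ / 2 + 1 / 2 = x - τ / 2 + 1 / 2 + τ by ring,
    jacobiTheta₂_add_left']
  have key : Complex.exp (cπ * I * τ / 4 - cπ * I * (x + τ)) *
      Complex.exp (-Real.pi * I * (τ + 2 * (x - τ / 2 + 1 / 2))) =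
      Complex.exp (-cπ * I * (2 * x + τ)) * Complex.exp (cπ * I * τ / 4 - cπ * I * x) *
      (Complex.exp (cπ * I))⁻¹ := by
    rw [← Complex.exp_neg, ← Complex.exp_add, ← Complex.exp_add, ← Complex.exp_add]
    simp only [cπ]
    ring_nf
  rw [exp_cpi] at key
  linear_combination (I * jacobiTheta₂ (x - τ / 2 + 1 / 2) τ) * key

lemma theta_neg (τ x : ℂ) : θf τ (-x) = -θf τ x := by
  rw [theta_eq, theta_eq, ← jacobiTheta₂_neg_left,
    show -(-x - τ / 2 + 1 / 2) = x - τ / 2 - 1 / 2 + τ by ring,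
    jacobiTheta₂_add_left', show x - τ / 2 + 1 / 2 = x - τ / 2 - 1 / 2 + 1 by ring,
    jacobiTheta₂_add_left]
  have : -(I * Complex.exp (cπ * I * τ / 4 - cπ * I * x)
      * jacobiTheta₂ (x - τ / 2 - 1 / 2) τ) =
      I * Complex.exp (cπ * I * τ / 4 - cπ * I * x + cπ * I)
      * jacobiTheta₂ (x - τ / 2 - 1 / 2) τ := by
    rw [Complex.exp_add _ (cπ * I), exp_cpi]; ring
  rw [this, mul_assoc, mul_assoc, ← mul_assoc (Complex.exp _) (Complex.exp _),
    ← Complex.exp_add]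
  simp only [cπ]
  ring_nf

lemma theta_zero (τ : ℂ) : θf τ 0 = 0 := by
  have := theta_neg τ 0
  rw [neg_zero] at this
  linear_combination this / 2

lemma theta_ne (t : ℝ) (ht : 0 < t) (τ : ℂ) (hτ : τ = t * I) : ∃ x, θf τ x ≠ 0 := by
  have him : 0 < τ.im := by subst hτ; simpa using ht
  refine ⟨τ / 2 - 1 / 2, ?_⟩
  rw [theta_eq, show τ / 2 - 1 / 2 - τ / 2 + 1 / 2 = (0:ℂ) by ring]
  refine mul_ne_zero (mul_ne_zero I_ne_zero (Complex.exp_ne_zero _)) ?_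
  have hs := hasSum_jacobiTheta₂_term 0 him
  have hterm : ∀ n : ℤ, jacobiTheta₂_term n 0 τ = ((Real.exp (-Real.pi * n ^ 2 * t) : ℝ) : ℂ) := by
    intro n
    rw [jacobiTheta₂_term, hτ]
    push_cast
    congr 1
    linear_combination (Real.pi * n ^ 2 * t : ℂ) * I_mul_I
  simp only [hterm] at hs
  have hr := Complex.hasSum_re hs
  simp only [Complex.ofReal_re] at hr
  intro h0
  rw [h0, Complex.zero_re] at hr
  have := (hasSum_zero_iff_of_nonneg (fun n => (Real.exp_pos _).le)).1 hr
  have := congrFun this 0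
  simp at this

/-- All zeros of `θ` are simple and in the lattice. -/
lemma theta_zeros (t : ℝ) (ht : 0 < t) (τ : ℂ) (hτ : τ = t * I) (x : ℂ) (hx : θf τ x = 0) :
    deriv (θf τ) x ≠ 0 ∧ ∃ m n : ℤ, x = m + n * τ := by
  have him : 0 < τ.im := by subst hτ; simpa using ht
  have hp := ee_tau_norm t ht τ hτ
  have dP := PP_diff τ hp
  have dθ := theta_diff τ him
  have hS : ∀ x, PP τ x = 0 →
      deriv (PP τ) x ≠ 0 ∧ θf τ x = 0 ∧ ∃ m n : ℤ, x = m + n * τ := by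
    refine box_induction t ht τ hτ _ ?_ ?_ ?_
    · intro x
      have hd : PP τ x = 0 → deriv (PP τ) (x + 1) = deriv (PP τ) x := by
        intro h
        have := deriv_zero_shift (PP τ) (fun _ => 1) 1 x dP (by fun_prop)
          (fun x => by rw [PP_add_one, one_mul]) h
        simpa using this
      rw [PP_add_one]
      refine imp_congr_right fun h => ?_
      rw [hd h, theta_add_one, neg_eq_zero]
      refine and_congr_right fun _ => and_congr_right fun _ => ?_
      constructor
      · rintro ⟨m, n, h⟩; exact ⟨m + 1, n, by rw [h]; push_cast; ring⟩
      · rintro ⟨m, n, h⟩; exact ⟨m - 1, n, by push_cast; linear_combination h⟩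
    · intro x
      have hd : PP τ x = 0 → deriv (PP τ) (x + τ) = -ee (-x) * deriv (PP τ) x := by
        intro h
        have h2 := ee_diff
        exact deriv_zero_shift (PP τ) (fun x => -ee (-x)) τ x dP (by fun_prop)
          (fun x => PP_add_tau τ x hp) h
      rw [PP_add_tau _ _ hp, mul_eq_zero, or_iff_right (neg_ne_zero.2 (ee_ne _))]
      refine imp_congr_right fun h => ?_
      rw [hd h, theta_add_tau, mul_eq_zero, or_iff_right (neg_ne_zero.2 (Complex.exp_ne_zero _)),
        mul_ne_zero_iff, and_iff_right (neg_ne_zero.2 (ee_ne _))]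
      refine and_congr_right fun _ => and_congr_right fun _ => ?_
      constructor
      · rintro ⟨m, n, h⟩; exact ⟨m, n + 1, by rw [h]; push_cast; ring⟩
      · rintro ⟨m, n, h⟩; exact ⟨m, n - 1, by push_cast; linear_combination h⟩
    · intro x h1 h2 h3 h4 h0
      obtain ⟨h5, h6⟩ := PP_box t ht τ hτ x h1 h2 h3 h4 h0
      exact ⟨h6, by rw [h5, theta_zero], 0, 0, by simp [h5]⟩
  -- quotient
  have dE : Differentiable ℂ fun x : ℂ => Complex.exp (cπ * I * x) := by fun_prop
  obtain ⟨q, dq, hq⟩ := exists_div_entire (PP τ) (fun x => Complex.exp (cπ * I * x) * θf τ x)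
    dP (dE.mul dθ) (fun x h => ⟨(hS x h).1, by simp [(hS x h).2.1]⟩)
  have q1 : ∀ x, q (x + 1) = q x := by
    refine cancel_entire (PP τ) (fun x => q (x + 1)) q dP (by fun_prop) dq
      (fun x h => (hS x h).1) (fun x => ?_)
    rw [hq x, ← PP_add_one, hq (x + 1), theta_add_one, mul_add, Complex.exp_add, mul_one, exp_cpi]
    ring
  have q2 : ∀ x, q (x + τ) = q x := by
    refine cancel_entire (PP τ) (fun x => q (x + τ)) q dP (by fun_prop) dq
      (fun x h => (hS x h).1) (fun x => ?_)
    have h1 := hq (x + τ)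
    rw [PP_add_tau _ _ hp, theta_add_tau, mul_add, Complex.exp_add] at h1
    have h2 : Complex.exp (cπ * I * τ) * Complex.exp (-cπ * I * (2 * x + τ)) = ee (-x) := by
      rw [← Complex.exp_add, ee]; ring_nf
    apply mul_left_cancel₀ (neg_ne_zero.2 (ee_ne (-x)))
    rw [hq x, ← mul_assoc, h1, ← h2]
    ring
  have hbd : ∃ C, ∀ x, ‖q x‖ ≤ C := by
    have hK : IsCompact (Set.Icc (0:ℝ) 1 ×ℂ Set.Icc (0:ℝ) t) := isCompact_Icc.reProdIm isCompact_Icc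
    obtain ⟨C, hC⟩ := hK.exists_bound_of_continuousOn dq.continuous.continuousOn
    refine ⟨C, box_induction t ht τ hτ _ (fun x => by rw [q1]) (fun x => by rw [q2]) ?_⟩
    intro x h1 h2 h3 h4
    exact hC x ⟨⟨h1, h2.le⟩, ⟨h3, h4.le⟩⟩
  obtain ⟨C, hC⟩ := hbd
  have hconst : ∀ y, q y = q 0 := fun y => dq.apply_eq_apply_of_bounded
    (isBounded_iff_forall_norm_le.2 ⟨C, by rintro _ ⟨x, rfl⟩; exact hC x⟩) y 0
  have hq0 : q 0 ≠ 0 := by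
    intro h0
    obtain ⟨y, hy⟩ := theta_ne t ht τ hτ
    have := hq y
    rw [hconst y, h0, mul_zero] at this
    exact mul_ne_zero (Complex.exp_ne_zero _) hy this.symm
  have hx' := hq x
  rw [hx, mul_zero, hconst, mul_eq_zero, or_iff_left hq0] at hx'
  obtain ⟨s1, s2, s3⟩ := hS x hx'
  refine ⟨fun hd => ?_, s3⟩
  have e1 := ((dE x).hasDerivAt.fun_mul (dθ x).hasDerivAt)
  have e2 := ((dP x).hasDerivAt.fun_mul (dq x).hasDerivAt)
  have : (fun y => PP τ y * q y) = fun y => Complex.exp (cπ * I * y) * θf τ y := funext hq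
  rw [this] at e2
  have e3 := e1.unique e2
  rw [hd, hx, hx', hconst x] at e3
  simp only [mul_zero, zero_mul, add_zero] at e3
  exact mul_ne_zero s1 hq0 e3.symm

/-- The difference operator Δ(a) is well defined and preserves Θ_N:
for f ∈ Θ_N there is a unique entire g with θ(2x)·g(x) equal to the defining
numerator, and g ∈ Θ_N. -/
theorem delta_well_defined_preserves_thetaSp
    (t : ℝ) (ht : 0 < t) (τ : ℂ) (hτ : τ = t * I)
    (N : ℕ) (η : ℂ) (a₁ a₂ a₃ a₄ : ℂ) (ha : a₁ + a₂ + a₃ + a₄ = 0)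
    (f : ℂ → ℂ) (hf : ThetaSp τ N f) :
    ∃ g : ℂ → ℂ,
      (Differentiable ℂ g ∧
        (∀ x, θf τ (2*x) * g x = ΔRHS τ η N a₁ a₂ a₃ a₄ f x) ∧
        ThetaSp τ N g) ∧
      (∀ g' : ℂ → ℂ, Differentiable ℂ g' →
        (∀ x, θf τ (2*x) * g' x = ΔRHS τ η N a₁ a₂ a₃ a₄ f x) → g' = g) := by
  have him : 0 < τ.im := by subst hτ; simpa using ht
  have dθ := theta_diff τ him
  obtain ⟨df, f1, f2, f3⟩ := hf
  have dH : Differentiable ℂ (ΔRHS τ η N a₁ a₂ a₃ a₄ f) := by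
    unfold ΔRHS
    fun_prop
  set H := ΔRHS τ η N a₁ a₂ a₃ a₄ f with hHdef
  have H1 : ∀ x, H (x + 1) = H x := by
    intro x
    have s : ∀ b c : ℂ, θf τ (x + 1 + b - c) = -θf τ (x + b - c) := fun b c => by
      rw [← theta_add_one]; ring_nf
    have s' : ∀ b c : ℂ, θf τ (x + 1 - b + c) = -θf τ (x - b + c) := fun b c => by
      rw [← theta_add_one]; ring_nf
    simp only [hHdef, ΔRHS, s, s']
    rw [show x + 1 + η = x + η + 1 by ring, show x + 1 - η = x - η + 1 by ring, f1, f1]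
    ring
  have H2 : ∀ x, H (x + τ) = Complex.exp (-2 * cπ * I * (N + 2) * (2 * x + τ)) * H x := by
    intro x
    have s : ∀ b c : ℂ, θf τ (x + τ + b - c)
        = -Complex.exp (-cπ * I * (2 * (x + b - c) + τ)) * θf τ (x + b - c) := fun b c => by
      rw [← theta_add_tau]; ring_nf
    have s' : ∀ b c : ℂ, θf τ (x + τ - b + c)
        = -Complex.exp (-cπ * I * (2 * (x - b + c) + τ)) * θf τ (x - b + c) := fun b c => by
      rw [← theta_add_tau]; ring_nf
    have ha4 : a₄ = -a₁ - a₂ - a₃ := by linear_combination ha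
    have k1 : Complex.exp (-cπ * I * (2 * (x + a₁ - N*η/2) + τ)) *
        Complex.exp (-cπ * I * (2 * (x + a₂ - N*η/2) + τ)) *
        Complex.exp (-cπ * I * (2 * (x + a₃ - N*η/2) + τ)) *
        Complex.exp (-cπ * I * (2 * (x + a₄ - N*η/2) + τ)) *
        Complex.exp (-2*cπ*I*N*(2*(x + η) + τ)) =
        Complex.exp (-2 * cπ * I * (N + 2) * (2 * x + τ)) := by
      simp only [← Complex.exp_add]
      rw [ha4]
      congr 1
      ring
    have k2 : Complex.exp (-cπ * I * (2 * (x - a₁ + N*η/2) + τ)) *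
        Complex.exp (-cπ * I * (2 * (x - a₂ + N*η/2) + τ)) *
        Complex.exp (-cπ * I * (2 * (x - a₃ + N*η/2) + τ)) *
        Complex.exp (-cπ * I * (2 * (x - a₄ + N*η/2) + τ)) *
        Complex.exp (-2*cπ*I*N*(2*(x - η) + τ)) =
        Complex.exp (-2 * cπ * I * (N + 2) * (2 * x + τ)) := by
      simp only [← Complex.exp_add]
      rw [ha4]
      congr 1
      ring
    simp only [hHdef, ΔRHS, s, s']
    rw [show x + τ + η = x + η + τ by ring, show x + τ - η = x - η + τ by ring, f2, f2]
    linear_combination (θf τ (x + a₁ - N*η/2) * θf τ (x + a₂ - N*η/2) *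
        θf τ (x + a₃ - N*η/2) * θf τ (x + a₄ - N*η/2) * f (x + η)) * k1
      - (θf τ (x - a₁ + N*η/2) * θf τ (x - a₂ + N*η/2) * θf τ (x - a₃ + N*η/2) *
        θf τ (x - a₄ + N*η/2) * f (x - η)) * k2
  have H3 : ∀ x, H (-x) = -H x := by
    intro x
    have s : ∀ b c : ℂ, θf τ (-x + b - c) = -θf τ (x - b + c) := fun b c => by
      rw [← theta_neg]; ring_nf
    have s' : ∀ b c : ℂ, θf τ (-x - b + c) = -θf τ (x + b - c) := fun b c => by
      rw [← theta_neg]; ring_nf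
    simp only [hHdef, ΔRHS, s, s']
    rw [show -x + η = -(x - η) by ring, show -x - η = -(x + η) by ring, f3, f3]
    ring
  -- the denominator
  have dD : Differentiable ℂ (fun x => θf τ (2 * x)) := by fun_prop
  have D1 : ∀ x, θf τ (2 * (x + 1)) = θf τ (2 * x) := by
    intro x
    rw [show 2 * (x + 1) = 2 * x + 1 + 1 by ring, theta_add_one, theta_add_one, neg_neg]
  have D2 : ∀ x, θf τ (2 * (x + τ)) =
      Complex.exp (-2 * cπ * I * 2 * (2 * x + τ)) * θf τ (2 * x) := by
    intro x
    rw [show 2 * (x + τ) = 2 * x + τ + τ by ring, theta_add_tau, theta_add_tau, ← mul_assoc,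
      neg_mul_neg, ← Complex.exp_add]
    congr 2
    ring
  have D3 : ∀ x, θf τ (2 * -x) = -θf τ (2 * x) := by
    intro x
    rw [show 2 * -x = -(2 * x) by ring, theta_neg]
  have hDs : ∀ x, θf τ (2 * x) = 0 → deriv (fun x => θf τ (2 * x)) x ≠ 0 := by
    intro x hx
    have h := (theta_zeros t ht τ hτ _ hx).1
    have h2 : HasDerivAt (fun x => θf τ (2 * x)) (deriv (θf τ) (2 * x) * (2 * 1)) x :=
      HasDerivAt.comp (h₂ := θf τ) (h := fun x => 2 * x) x (dθ (2 * x)).hasDerivAt ((hasDerivAt_id x).const_mul 2)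
    rw [h2.deriv]
    simpa using h
  have hDH : ∀ x, θf τ (2 * x) = 0 → H x = 0 := by
    refine box_induction t ht τ hτ _ ?_ ?_ ?_
    · intro x; rw [D1, H1]
    · intro x
      rw [D2, H2, mul_eq_zero, mul_eq_zero, or_iff_right (Complex.exp_ne_zero _),
        or_iff_right (Complex.exp_ne_zero _)]
    · intro x h1 h2 h3 h4 h0
      obtain ⟨m, n, hmn⟩ := (theta_zeros t ht τ hτ _ h0).2
      have hre : 2 * x.re = m := by
        have := congrArg Complex.re hmn
        rw [hτ] at this
        simpa using this
      have him : 2 * x.im = n * t := by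
        have := congrArg Complex.im hmn
        rw [hτ] at this
        simpa using this
      have m0 : (-1 : ℤ) < m := by
        have : (-1 : ℝ) < m := by linarith
        exact_mod_cast this
      have m1 : m < (2 : ℤ) := by
        have : (m : ℝ) < 2 := by linarith
        exact_mod_cast this
      have n0 : (-1 : ℤ) < n := by
        have : (-1 : ℝ) < n := by nlinarith
        exact_mod_cast this
      have n1 : n < (2 : ℤ) := by
        have : (n : ℝ) < 2 := by nlinarith
        exact_mod_cast this
      have hx : x = (m + n * τ) / 2 := by rw [← hmn]; ring
      have fin : H x = H (-x) → H x = 0 := by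
        intro h
        rw [H3] at h
        linear_combination h / 2
      apply fin
      have hm : m = 0 ∨ m = 1 := by omega
      have hn : n = 0 ∨ n = 1 := by omega
      rcases hm with rfl | rfl <;> rcases hn with rfl | rfl
      · have : x = 0 := by rw [hx]; simp
        rw [this, neg_zero]
      · have e := H2 (-x)
        have e1 : -x + τ = x := by rw [hx]; push_cast; ring
        have e2 : 2 * -x + τ = 0 := by rw [hx]; push_cast; ring
        rw [e1, e2, mul_zero, Complex.exp_zero, one_mul] at e
        exact e
      · have e := H1 (-x)
        have e1 : -x + 1 = x := by rw [hx]; push_cast; ring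
        rw [e1] at e
        exact e
      · have e := H2 (-x + 1)
        have e1 : -x + 1 + τ = x := by rw [hx]; push_cast; ring
        have e2 : 2 * (-x + 1) + τ = 1 := by rw [hx]; push_cast; ring
        have e3 : Complex.exp (-2 * cπ * I * (N + 2) * 1) = 1 := by
          rw [Complex.exp_eq_one_iff]
          exact ⟨-(N + 2), by simp only [cπ]; push_cast; ring⟩
        rw [e1, e2, e3, one_mul, H1] at e
        exact e
  obtain ⟨g, dg, hg⟩ := exists_div_entire (fun x => θf τ (2 * x)) H dD dH
    (fun x h => ⟨hDs x h, hDH x h⟩)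
  refine ⟨g, ⟨dg, hg, dg, ?_, ?_, ?_⟩, ?_⟩
  · refine cancel_entire (fun x => θf τ (2 * x)) (fun x => g (x + 1)) g dD (by fun_prop) dg hDs
      (fun x => ?_)
    have e := hg (x + 1)
    have e' := hg x
    simp only [D1, H1] at e e' ⊢
    rw [e, e']
  · refine cancel_entire (fun x => θf τ (2 * x)) (fun x => g (x + τ))
      (fun x => Complex.exp (-2*cπ*I*N*(2*x + τ)) * g x) dD (by fun_prop) (by fun_prop) hDs
      (fun x => ?_)
    have e := hg (x + τ)
    have e' := hg x
    simp only [D2, H2] at e e' ⊢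
    apply mul_left_cancel₀ (Complex.exp_ne_zero (-2 * cπ * I * 2 * (2 * x + τ)))
    rw [← mul_assoc, e, mul_left_comm (θf τ (2 * x)), e', ← mul_assoc, ← Complex.exp_add]
    congr 2
    ring
  · refine cancel_entire (fun x => θf τ (2 * x)) (fun x => g (-x)) g dD (by fun_prop) dg hDs
      (fun x => ?_)
    have e := hg (-x)
    have e' := hg x
    simp only [D3, H3] at e e' ⊢
    linear_combination -e - e'
  · intro g' dg' hg'
    funext x
    exact cancel_entire (fun x => θf τ (2 * x)) g' g dD dg' dg hDs
      (fun x => by rw [hg' x]; exact (hg x).symm) x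
end
end

section
/- (Frenkel–Turaev summation.) Let N be a nonnegative integer, η ∈ ℂ, and a, b, c, d, e ∈ ℂ with b+c+d+e = 2a+N+1. Assume that [a] ≠ 0 and that all elliptic shifted factorials appearing in denominators below are nonzero ([1]_k, [a+1−b]_k, [a+1−c]_k, [a+1−d]_k, [a+1−e]_k, [a+1+N]_k for 0 ≤ k ≤ N, and [a+1−b]_N, [a+1−c]_N, [a+1−d]_N, [a+1−b−c−d]_N). Then Σ_{k=0}^N ([a+2k]/[a]) · ([a]_k [b]_k [c]_k [d]_k [e]_k [−N]_k) / ([1]_k [a+1−b]_k [a+1−c]_k [a+1−d]_k [a+1−e]_k [a+1+N]_k) = ([a+1]_N [a+1−b−c]_N [a+1−b−d]_N [a+1−c−d]_N) / ([a+1−b]_N [a+1−c]_N [a+1−d]_N [a+1−b−c−d]_N). -/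
noncomputable section
open Complex MeasureTheory

/-- terms of the theta series -/
def thT (τ : ℂ) (n : ℤ) (x : ℂ) : ℂ := (-1 : ℂ) ^ n *
    Complex.exp (cπ * I * τ * ((n : ℂ) - 1/2)^2 + cπ * I * (2*(n : ℂ) - 1) * x)

lemma neg_one_zpow_exp (n : ℤ) : (-1 : ℂ) ^ n = Complex.exp (cπ * I * n) := by
  rw [← Complex.exp_pi_mul_I, ← Complex.exp_int_mul]
  congr 1; rw [cπ]; ring

lemma thT_eq (τ : ℂ) (n : ℤ) (x : ℂ) : thT τ n x =
    Complex.exp (cπ * I * τ / 4 - cπ * I * x) * jacobiTheta₂_term n (x + 1/2 - τ/2) τ := by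
  rw [thT, neg_one_zpow_exp, jacobiTheta₂_term, ← Complex.exp_add, ← Complex.exp_add]
  congr 1; rw [cπ]; ring

lemma θf_eq (τ x : ℂ) : θf τ x =
    I * (Complex.exp (cπ * I * τ / 4 - cπ * I * x) * jacobiTheta₂ (x + 1/2 - τ/2) τ) := by
  have h : θf τ x = I * ∑' n, thT τ n x := rfl
  rw [h, jacobiTheta₂, ← tsum_mul_left (f := fun n => jacobiTheta₂_term n (x + 1/2 - τ/2) τ)]
  congr 1
  exact tsum_congr fun n => thT_eq τ n x

lemma θf_differentiable {τ : ℂ} (hτ : 0 < τ.im) : Differentiable ℂ (θf τ) := by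
  have : θf τ = fun x => I * (Complex.exp (cπ * I * τ / 4 - cπ * I * x) *
    jacobiTheta₂ (x + 1/2 - τ/2) τ) := funext (θf_eq τ)
  rw [this]
  intro x
  have h : DifferentiableAt ℂ (fun x : ℂ => jacobiTheta₂ (x + 1/2 - τ/2) τ) x :=
    (differentiableAt_jacobiTheta₂_fst (x + 1/2 - τ/2) hτ).comp (f := fun x : ℂ => x + 1/2 - τ/2) x
      (by fun_prop)
  fun_prop

lemma thT_summable {τ : ℂ} (hτ : 0 < τ.im) (x : ℂ) : Summable (fun n => thT τ n x) := by
  simp_rw [thT_eq]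
  exact ((summable_jacobiTheta₂_term_iff _ _).2 hτ).mul_left _

def thE (τ : ℂ) (k : ℤ) (x : ℂ) : ℂ := jacobiTheta₂_term k (2*x) (2*τ)

def thO (τ : ℂ) (k : ℤ) (x : ℂ) : ℂ :=
  Complex.exp (cπ * I * τ / 2 + 2 * cπ * I * x) * jacobiTheta₂_term k (2*x+τ) (2*τ)

lemma two_im {τ : ℂ} (hτ : 0 < τ.im) : 0 < (2*τ).im := by simpa using hτ

lemma thE_summable {τ : ℂ} (hτ : 0 < τ.im) (x : ℂ) : Summable (fun n => thE τ n x) :=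
  (summable_jacobiTheta₂_term_iff _ _).2 (two_im hτ)

lemma thO_summable {τ : ℂ} (hτ : 0 < τ.im) (x : ℂ) : Summable (fun n => thO τ n x) :=
  ((summable_jacobiTheta₂_term_iff _ _).2 (two_im hτ)).mul_left _

lemma hasSum_prod {f g : ℤ → ℂ} (hf : Summable f) (hg : Summable g) :
    HasSum (fun p : ℤ × ℤ => f p.1 * g p.2) ((∑' n, f n) * ∑' n, g n) := by
  rw [tsum_mul_tsum_of_summable_norm hf.norm hg.norm]
  exact (summable_mul_of_summable_norm hf.norm hg.norm).hasSum

lemma exp_odd (k : ℤ) (z : ℂ) :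
    Complex.exp (z + cπ * I * (2 * k + 1)) = - Complex.exp z := by
  have : z + cπ * I * (2 * k + 1) = z + cπ * I + k * (2 * Real.pi * I) := by rw [cπ]; ring
  rw [this, Complex.exp_add, Complex.exp_int_mul_two_pi_mul_I, Complex.exp_add, cπ,
    Complex.exp_pi_mul_I]
  ring

lemma exp_even (k : ℤ) (z : ℂ) :
    Complex.exp (z + cπ * I * (2 * k)) = Complex.exp z := by
  have : z + cπ * I * (2 * k) = z + k * (2 * Real.pi * I) := by rw [cπ]; ring
  rw [this, Complex.exp_add, Complex.exp_int_mul_two_pi_mul_I]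
  ring

lemma term_one (τ x y : ℂ) (k l : ℤ) :
    thT τ (k+l+1) (x+y) * thT τ (k-l) (x-y) = - (thE τ k x * thO τ l y) := by
  simp only [thT, thE, thO, neg_one_zpow_exp, jacobiTheta₂_term, ← Complex.exp_add]
  rw [← exp_odd k]
  congr 1; push_cast; simp only [cπ]; ring

lemma term_two (τ x y : ℂ) (k l : ℤ) :
    thT τ (k+l+1) (x+y) * thT τ (k-l+1) (x-y) = thO τ k x * thE τ l y := by
  simp only [thT, thE, thO, neg_one_zpow_exp, jacobiTheta₂_term, ← Complex.exp_add]
  refine Eq.trans ?_ (exp_even (k+1) _)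
  congr 1; push_cast; simp only [cπ]; ring

lemma θf_AB {τ : ℂ} (hτ : 0 < τ.im) (x y : ℂ) : θf τ (x+y) * θf τ (x-y) =
    (∑' n, thE τ n x) * (∑' n, thO τ n y) - (∑' n, thO τ n x) * (∑' n, thE τ n y) := by
  have h1 := (hasSum_prod (thE_summable hτ x) (thO_summable hτ y)).neg
  have h2 := hasSum_prod (thO_summable hτ x) (thE_summable hτ y)
  have h3 := hasSum_prod (thT_summable hτ (x+y)) (thT_summable hτ (x-y))
  let i1 : ℤ × ℤ → ℤ × ℤ := fun p => (p.1+p.2+1, p.1-p.2)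
  let i2 : ℤ × ℤ → ℤ × ℤ := fun p => (p.1+p.2+1, p.1-p.2+1)
  have j1 : Function.Injective i1 := by
    rintro ⟨a, b⟩ ⟨c, d⟩ h
    simp only [i1, Prod.mk.injEq] at h ⊢
    omega
  have j2 : Function.Injective i2 := by
    rintro ⟨a, b⟩ ⟨c, d⟩ h
    simp only [i2, Prod.mk.injEq] at h ⊢
    omega
  have hc : IsCompl (Set.range i1) (Set.range i2) := by
    constructor
    · rw [Set.disjoint_left]
      rintro _ ⟨⟨a, b⟩, rfl⟩ ⟨⟨c, d⟩, h⟩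
      simp only [i1, i2, Prod.mk.injEq] at h
      omega
    · rw [codisjoint_iff_le_sup]
      rintro ⟨m, n⟩ -
      rcases Int.even_or_odd' (m - n) with ⟨q, hq | hq⟩
      · right
        refine ⟨(q + n - 1, q), ?_⟩
        simp only [i2, Prod.mk.injEq]
        omega
      · left
        refine ⟨(q + n, q), ?_⟩
        simp only [i1, Prod.mk.injEq]
        omega
  let F : ℤ × ℤ → ℂ := fun p => thT τ p.1 (x+y) * thT τ p.2 (x-y)
  have k1 : HasSum (F ∘ ((↑) : Set.range i1 → ℤ × ℤ)) (-((∑' n, thE τ n x) * (∑' n, thO τ n y))) := by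
    refine j1.hasSum_range_iff.2 ?_
    have hh : F ∘ i1 = fun p => -(thE τ p.1 x * thO τ p.2 y) :=
      funext fun p => term_one τ x y p.1 p.2
    rw [hh]; exact h1
  have k2 : HasSum (F ∘ ((↑) : Set.range i2 → ℤ × ℤ)) ((∑' n, thO τ n x) * (∑' n, thE τ n y)) := by
    refine j2.hasSum_range_iff.2 ?_
    have hh : F ∘ i2 = fun p => thO τ p.1 x * thE τ p.2 y :=
      funext fun p => term_two τ x y p.1 p.2
    rw [hh]; exact h2
  have h4 := h3.unique (HasSum.add_isCompl hc k1 k2)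
  have h5 : ∀ z, θf τ z = I * ∑' n, thT τ n z := fun z => rfl
  rw [h5, h5]
  linear_combination (-1 : ℂ) * h4 + (∑' n, thT τ n (x+y)) * (∑' n, thT τ n (x-y)) * Complex.I_sq

lemma θf_odd {τ : ℂ} (hτ : 0 < τ.im) (v : ℂ) : θf τ (-v) = - θf τ v := by
  by_cases h : ∀ u, θf τ u = 0
  · simp [h]
  · push Not at h
    obtain ⟨u, hu⟩ := h
    have e1 := θf_AB hτ ((u+v)/2) ((u-v)/2)
    have e2 := θf_AB hτ ((u-v)/2) ((u+v)/2)
    rw [show (u+v)/2 + (u-v)/2 = u by ring, show (u+v)/2 - (u-v)/2 = v by ring] at e1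
    rw [show (u-v)/2 + (u+v)/2 = u by ring, show (u-v)/2 - (u+v)/2 = -v by ring] at e2
    apply mul_left_cancel₀ hu
    linear_combination e1 + e2

lemma θf_tri {τ : ℂ} (hτ : 0 < τ.im) (p q r b c s : ℂ) (hs : s = -(b + c)) :
    θf τ (p+b) * θf τ (p+c) * θf τ (q+r-s) * θf τ (q-r) +
    θf τ (q+b) * θf τ (q+c) * θf τ (r+p-s) * θf τ (r-p) +
    θf τ (r+b) * θf τ (r+c) * θf τ (p+q-s) * θf τ (p-q) = 0 := by
  have key : ∀ x z : ℂ, ∀ u v, u = x + z → v = x - z → θf τ u * θf τ v =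
    (∑' n, thE τ n x) * (∑' n, thO τ n z) - (∑' n, thO τ n x) * (∑' n, thE τ n z) := by
    rintro x z _ _ rfl rfl; exact θf_AB hτ x z
  have a1 := key (p+(b+c)/2) ((b-c)/2) (p+b) (p+c) (by ring) (by ring)
  have a2 := key (q+(b+c)/2) ((b-c)/2) (q+b) (q+c) (by ring) (by ring)
  have a3 := key (r+(b+c)/2) ((b-c)/2) (r+b) (r+c) (by ring) (by ring)
  have b1 := key (q+(b+c)/2) (r+(b+c)/2) (q+r-s) (q-r) (by rw [hs]; ring) (by ring)
  have b2 := key (r+(b+c)/2) (p+(b+c)/2) (r+p-s) (r-p) (by rw [hs]; ring) (by ring)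
  have b3 := key (p+(b+c)/2) (q+(b+c)/2) (p+q-s) (p-q) (by rw [hs]; ring) (by ring)
  rw [a1, a2, a3, mul_assoc, mul_assoc, mul_assoc, b1, b2, b3]
  ring

/-- the six-parameter identity multiplied by a redundant factor -/
lemma θf_six_aux {τ : ℂ} (hτ : 0 < τ.im) (x L M b₁ b₂ b₃ b₄ : ℂ)
    (h : b₁ + b₂ + b₃ + b₄ = M - L) :
    θf τ (b₃ + b₄) * (θf τ (L+M) *
      (θf τ (x+b₁) * θf τ (x+b₂) * θf τ (x+b₃) * θf τ (x+b₄) * θf τ (L+x) * θf τ (M-x)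
      - θf τ (x-b₁) * θf τ (x-b₂) * θf τ (x-b₃) * θf τ (x-b₄) * θf τ (L-x) * θf τ (M+x)) +
    θf τ (2*x) * (θf τ (L+x) * θf τ (L-x) *
        (θf τ (M-b₁) * θf τ (M-b₂) * θf τ (M-b₃) * θf τ (M-b₄)) -
      θf τ (M-x) * θf τ (M+x) *
        (θf τ (L+b₁) * θf τ (L+b₂) * θf τ (L+b₃) * θf τ (L+b₄)))) = 0 := by
  have neg : ∀ u v : ℂ, u = -v → θf τ u = - θf τ v := by rintro _ v rfl; exact θf_odd hτ v
  have P1 : ∀ x, -(θf τ (x+b₁) * θf τ (x+b₂) * θf τ (b₃+b₄) * θf τ (L+M)) +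
      θf τ (L+b₁) * θf τ (L+b₂) * θf τ (L+b₃+b₄-x) * θf τ (M+x) -
      θf τ (M-b₁) * θf τ (M-b₂) * θf τ (L+b₁+b₂+x) * θf τ (L-x) = 0 := by
    intro x
    have e := θf_tri hτ x L (-M) b₁ b₂ _ rfl
    rw [neg (L + -M - -(b₁+b₂)) (b₃+b₄) (by linear_combination h),
      show L - -M = L + M by ring,
      neg (-M + x - -(b₁+b₂)) (L+b₃+b₄-x) (by linear_combination h),
      neg (-M-x) (M+x) (by ring), neg (-M+b₁) (M-b₁) (by ring), neg (-M+b₂) (M-b₂) (by ring),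
      show x + L - -(b₁+b₂) = L+b₁+b₂+x by ring, neg (x-L) (L-x) (by ring)] at e
    linear_combination e
  have P3 : ∀ L, θf τ (L+x) * θf τ (x+b₃) * θf τ (x+b₄) * θf τ (L+b₃+b₄-x) -
      θf τ (L-x) * θf τ (x-b₃) * θf τ (x-b₄) * θf τ (L+b₃+b₄+x) -
      θf τ (2*x) * θf τ (L+b₃) * θf τ (L+b₄) * θf τ (b₃+b₄) = 0 := by
    intro L
    have e := θf_tri hτ x (-x) L b₃ b₄ _ rfl
    rw [show -x + L - -(b₃+b₄) = L+b₃+b₄-x by ring, neg (-x-L) (L+x) (by ring),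
      neg (-x+b₃) (x-b₃) (by ring), neg (-x+b₄) (x-b₄) (by ring),
      show L + x - -(b₃+b₄) = L+b₃+b₄+x by ring, show x + -x - -(b₃+b₄) = b₃+b₄ by ring,
      show x - -x = 2*x by ring] at e
    linear_combination -e
  have e1 := P1 x
  have e2 := P1 (-x)
  have e3 := P3 L
  have e4 := P3 (-M)
  rw [neg (-x+b₁) (x-b₁) (by ring), neg (-x+b₂) (x-b₂) (by ring),
    show L+b₃+b₄- -x = L+b₃+b₄+x by ring, show M + -x = M - x by ring,
    show L - -x = L + x by ring, show L+b₁+b₂+ -x = L+b₁+b₂-x by ring] at e2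
  rw [neg (-M+x) (M-x) (by ring), neg (-M-x) (M+x) (by ring),
    neg (-M+b₃+b₄-x) (L+b₁+b₂+x) (by linear_combination h),
    neg (-M+b₃+b₄+x) (L+b₁+b₂-x) (by linear_combination h),
    neg (-M+b₃) (M-b₃) (by ring), neg (-M+b₄) (M-b₄) (by ring)] at e4
  linear_combination
    (-(θf τ (L+x) * θf τ (M-x) * θf τ (x+b₃) * θf τ (x+b₄))) * e1
    + (θf τ (L-x) * θf τ (M+x) * θf τ (x-b₃) * θf τ (x-b₄)) * e2
    + (θf τ (L+b₁) * θf τ (L+b₂) * θf τ (M-x) * θf τ (M+x)) * e3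
    - (θf τ (M-b₁) * θf τ (M-b₂) * θf τ (L-x) * θf τ (L+x)) * e4

lemma θf_six {τ : ℂ} (hτ : 0 < τ.im) (x L M b₁ b₂ b₃ b₄ : ℂ)
    (h : b₁ + b₂ + b₃ + b₄ = M - L) :
    θf τ (L+M) *
      (θf τ (x+b₁) * θf τ (x+b₂) * θf τ (x+b₃) * θf τ (x+b₄) * θf τ (L+x) * θf τ (M-x)
      - θf τ (x-b₁) * θf τ (x-b₂) * θf τ (x-b₃) * θf τ (x-b₄) * θf τ (L-x) * θf τ (M+x)) +
    θf τ (2*x) * (θf τ (L+x) * θf τ (L-x) *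
        (θf τ (M-b₁) * θf τ (M-b₂) * θf τ (M-b₃) * θf τ (M-b₄)) -
      θf τ (M-x) * θf τ (M+x) *
        (θf τ (L+b₁) * θf τ (L+b₂) * θf τ (L+b₃) * θf τ (L+b₄))) = 0 := by
  have hd := θf_differentiable hτ
  let g : ℂ → ℂ := fun s => θf τ (b₃ + s + b₄)
  let F : ℂ → ℂ := fun s => θf τ (L-s+M) *
      (θf τ (x+b₁) * θf τ (x+b₂) * θf τ (x+(b₃+s)) * θf τ (x+b₄) * θf τ (L-s+x) * θf τ (M-x)
      - θf τ (x-b₁) * θf τ (x-b₂) * θf τ (x-(b₃+s)) * θf τ (x-b₄) * θf τ (L-s-x) * θf τ (M+x)) +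
    θf τ (2*x) * (θf τ (L-s+x) * θf τ (L-s-x) *
        (θf τ (M-b₁) * θf τ (M-b₂) * θf τ (M-(b₃+s)) * θf τ (M-b₄)) -
      θf τ (M-x) * θf τ (M+x) *
        (θf τ (L-s+b₁) * θf τ (L-s+b₂) * θf τ (L-s+(b₃+s)) * θf τ (L-s+b₄)))
  have hg : Differentiable ℂ g := hd.comp (f := fun s => b₃ + s + b₄) (by fun_prop)
  have hF : Differentiable ℂ F := by
    have c1 : ∀ u : ℂ → ℂ, Differentiable ℂ u → Differentiable ℂ (fun s => θf τ (u s)) :=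
      fun u hu => hd.comp hu
    have d1 := c1 (fun s => L-s+M) (by fun_prop)
    have d2 := c1 (fun s => x+(b₃+s)) (by fun_prop)
    have d3 := c1 (fun s => L-s+x) (by fun_prop)
    have d4 := c1 (fun s => x-(b₃+s)) (by fun_prop)
    have d5 := c1 (fun s => L-s-x) (by fun_prop)
    have d6 := c1 (fun s => M-(b₃+s)) (by fun_prop)
    have d7 := c1 (fun s => L-s+b₁) (by fun_prop)
    have d8 := c1 (fun s => L-s+b₂) (by fun_prop)
    have d9 := c1 (fun s => L-s+(b₃+s)) (by fun_prop)
    have d10 := c1 (fun s => L-s+b₄) (by fun_prop)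
    fun_prop
  have hgF : ∀ s, g s * F s = 0 := fun s =>
    θf_six_aux hτ x (L-s) M b₁ b₂ (b₃+s) b₄ (by linear_combination h)
  have hF0 : F 0 = 0 := by
    by_cases hz : ∀ u, θf τ u = 0
    · simp [F, hz]
    · push Not at hz
      obtain ⟨u, hu⟩ := hz
      by_contra hne
      have ev : ∀ᶠ s in nhds (0:ℂ), g s = 0 := by
        filter_upwards [hF.continuous.continuousAt.eventually_ne hne] with s hs
        exact (mul_eq_zero.1 (hgF s)).resolve_right hs
      have := (hg.differentiableOn.analyticOnNhd isOpen_univ).eqOn_zero_of_preconnected_of_eventuallyEq_zero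
        isPreconnected_univ (Set.mem_univ 0) ev
      have h0 := this (Set.mem_univ (u - b₃ - b₄))
      apply hu
      have h1 : g (u - b₃ - b₄) = θf τ u := by
        simp only [g]; congr 1; ring
      rw [← h1]; exact h0
  simpa [F] using hF0

def fac (f : ℂ → ℂ) (x : ℂ) (k : ℕ) : ℂ := ∏ j ∈ Finset.range k, f (x + j)

lemma fac_zero (f : ℂ → ℂ) (x : ℂ) : fac f x 0 = 1 := by simp [fac]

lemma fac_last (f : ℂ → ℂ) (x y : ℂ) (n : ℕ) (h : y = x + n) :
    fac f x (n+1) = fac f x n * f y := by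
  rw [fac, Finset.prod_range_succ, h]; rfl

lemma fac_first (f : ℂ → ℂ) (x y : ℂ) (n : ℕ) (h : y = x + 1) :
    fac f x (n+1) = f x * fac f y n := by
  rw [fac, Finset.prod_range_succ', mul_comm, fac, h]
  congr 1
  · simp
  · apply Finset.prod_congr rfl
    intro j _
    congr 1; push_cast; ring

lemma fac_split (f : ℂ → ℂ) (x y : ℂ) (N k l : ℕ) (h : N = k + l) (hy : y = x + k) :
    fac f x N = fac f x k * fac f y l := by
  rw [fac, h, Finset.prod_range_add, fac, fac, hy]
  congr 1
  apply Finset.prod_congr rfl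
  intro j _
  congr 1; push_cast; ring

lemma fac_refl (f : ℂ → ℂ) (hodd : ∀ x, f (-x) = - f x) (y : ℂ) (N k : ℕ) :
    ∀ l, N = k + l → fac f (1 - y - N) k * fac f y l = (-1)^k * fac f y N := by
  induction k with
  | zero => intro l h; simp [fac_zero, h]
  | succ k ih =>
    intro l h
    have e := ih (l+1) (by omega)
    rw [fac_last f y (y+l) l rfl] at e
    rw [fac_last f (1 - y - N) (-(y+l)) k (by rw [h]; push_cast; ring), hodd, pow_succ]
    linear_combination -e

def fU (f : ℂ → ℂ) (a b c d r : ℂ) (N k l : ℕ) : ℂ :=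
  f (a+2*k) * fac f a k * fac f (a+k+N+1) l * (fac f b k * fac f c k * fac f d k) *
    fac f (r+N) k * fac f (r-a) l *
    (fac f (a+1-b+k) l * fac f (a+1-c+k) l * fac f (a+1-d+k) l) / (fac f 1 k * fac f 1 l)

def fH (f : ℂ → ℂ) (a b c d r : ℂ) (N k l : ℕ) : ℂ :=
  fac f a (k+1) * (fac f b (k+1) * fac f c (k+1) * fac f d (k+1)) *
    fac f (a+k+N+2) (l+1) * fac f (r-a) l * fac f (r+N+1) k *
    (fac f (a+1-b+k) l * fac f (a+1-c+k) l * fac f (a+1-d+k) l) / (fac f 1 k * fac f 1 l)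

def fρ (f : ℂ → ℂ) (a b c d : ℂ) (N : ℕ) : ℂ :=
  f (a+2*N+1) * f (a+2*N+2) * (f (a+1-b-c+N) * f (a+1-b-d+N) * f (a+1-c-d+N)) / f (N+1)

def Tri (f : ℂ → ℂ) : Prop := ∀ p q r b c s : ℂ, s = -(b + c) →
    f (p+b) * f (p+c) * f (q+r-s) * f (q-r) +
    f (q+b) * f (q+c) * f (r+p-s) * f (r-p) +
    f (r+b) * f (r+c) * f (p+q-s) * f (p-q) = 0

def Six (f : ℂ → ℂ) : Prop := ∀ (x L M b₁ b₂ b₃ b₄ : ℂ), b₁ + b₂ + b₃ + b₄ = M - L →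
    f (L+M) *
      (f (x+b₁) * f (x+b₂) * f (x+b₃) * f (x+b₄) * f (L+x) * f (M-x)
      - f (x-b₁) * f (x-b₂) * f (x-b₃) * f (x-b₄) * f (L-x) * f (M+x)) +
    f (2*x) * (f (L+x) * f (L-x) *
        (f (M-b₁) * f (M-b₂) * f (M-b₃) * f (M-b₄)) -
      f (M-x) * f (M+x) *
        (f (L+b₁) * f (L+b₂) * f (L+b₃) * f (L+b₄))) = 0

lemma six_spec (f : ℂ → ℂ) (hs : Six f) (a b c d r k l N : ℂ) (hr : b+c+d+r = 2*a+1)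
    (hN : N = k + l) :
    f (r+2*N+1) * (f (a+k) * f (b+k) * f (c+k) * f (d+k) * f (r+N+k) * f (l+1)
      - f k * f (a-b+k) * f (a-c+k) * f (a-d+k) * f (r-a+l) * f (a+k+N+1)) +
    f (a+2*k) * (f (r+N+k) * f (r-a+l) *
        (f (N+1) * f (a+1-b+N) * f (a+1-c+N) * f (a+1-d+N)) -
      f (l+1) * f (a+k+N+1) *
        (f (r+N) * f (a+1-c-d+N) * f (a+1-b-d+N) * f (a+1-b-c+N))) = 0 := by
  have h := hs (a/2+k) (r+N-a/2) (N+1+a/2) (a/2) (b-a/2) (c-a/2) (d-a/2)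
    (by linear_combination hr)
  rw [show r+N-a/2+(N+1+a/2) = r+2*N+1 by ring, show a/2+k+a/2 = a+k by ring,
    show a/2+k+(b-a/2) = b+k by ring, show a/2+k+(c-a/2) = c+k by ring,
    show a/2+k+(d-a/2) = d+k by ring, show r+N-a/2+(a/2+k) = r+N+k by ring,
    show N+1+a/2-(a/2+k) = l+1 by rw [hN]; ring, show a/2+k-a/2 = k by ring,
    show a/2+k-(b-a/2) = a-b+k by ring, show a/2+k-(c-a/2) = a-c+k by ring,
    show a/2+k-(d-a/2) = a-d+k by ring, show r+N-a/2-(a/2+k) = r-a+l by rw [hN]; ring,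
    show N+1+a/2+(a/2+k) = a+k+N+1 by ring, show 2*(a/2+k) = a+2*k by ring,
    show N+1+a/2-a/2 = N+1 by ring, show N+1+a/2-(b-a/2) = a+1-b+N by ring,
    show N+1+a/2-(c-a/2) = a+1-c+N by ring, show N+1+a/2-(d-a/2) = a+1-d+N by ring,
    show r+N-a/2+a/2 = r+N by ring, show r+N-a/2+(b-a/2) = a+1-c-d+N by linear_combination hr,
    show r+N-a/2+(c-a/2) = a+1-b-d+N by linear_combination hr,
    show r+N-a/2+(d-a/2) = a+1-b-c+N by linear_combination hr] at h
  exact h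

lemma step_zero (f : ℂ → ℂ) (hodd : ∀ x, f (-x) = - f x) (ht : Tri f) (a b c d r : ℂ)
    (hr : b+c+d+r = 2*a+1) (N : ℕ) (hN : ∀ k ≤ N+1, fac f 1 k ≠ 0) :
    fU f a b c d r (N+1) 0 (N+1) - fρ f a b c d N * fU f a b c d r N 0 N =
      - f (r+2*N+1) / f (N+1) * fH f a b c d r N 0 N := by
  have n1 := hN N (by omega)
  have n2 := hN (N+1) le_rfl
  rw [fac_last f 1 (N+1) N (by ring)] at n2
  have n3 := right_ne_zero_of_mul n2
  have e2 : fac f (a+(0:ℕ)+N+1) N * (f (a+2*N+1) * f (a+2*N+2)) =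
      f (a+N+1) * fac f (a+N+2) (N+1) := by
    have := fac_first f (a+N+1) (a+N+2) (N+1) (by ring)
    rw [← this, fac_last f (a+N+1) (a+2*N+2) (N+1) (by push_cast; ring),
      fac_last f (a+N+1) (a+2*N+1) N (by ring)]
    simp; ring
  have h3 := ht 0 (a+N+1) (a+N+1-d) (-b) (-c) (b+c) (by ring)
  rw [show (0:ℂ)+-b = -b by ring, show (0:ℂ)+-c = -c by ring, hodd, hodd,
    show a+N+1+(a+N+1-d)-(b+c) = r+2*N+1 by linear_combination -hr,
    show a+N+1-(a+N+1-d) = d by ring, show a+N+1+-b = a+1-b+N by ring,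
    show a+N+1+-c = a+1-c+N by ring, show a+N+1-d+0-(b+c) = r-a+N by linear_combination -hr,
    show a+N+1-d-0 = a+1-d+N by ring, show a+N+1-d+-b = a+1-b-d+N by ring,
    show a+N+1-d+-c = a+1-c-d+N by ring, show 0+(a+N+1)-(b+c) = a+1-b-c+N by ring,
    show 0-(a+N+1) = -(a+N+1) by ring, hodd] at h3
  have hU0 : fρ f a b c d N * fU f a b c d r N 0 N =
      f a * (f (a+N+1) * fac f (a+N+2) (N+1)) * fac f (r-a) N *
      (fac f (a+1-b) N * fac f (a+1-c) N * fac f (a+1-d) N) *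
      (f (a+1-b-c+N) * f (a+1-b-d+N) * f (a+1-c-d+N)) / (fac f 1 N * f (N+1)) := by
    rw [← e2, fρ, fU]
    simp only [fac_zero, Nat.cast_zero, mul_zero, add_zero]
    ring
  have hU1 : fU f a b c d r (N+1) 0 (N+1) =
      f a * fac f (a+N+2) (N+1) * (fac f (r-a) N * f (r-a+N)) *
      (fac f (a+1-b) N * f (a+1-b+N) * (fac f (a+1-c) N * f (a+1-c+N)) *
      (fac f (a+1-d) N * f (a+1-d+N))) / (fac f 1 N * f (N+1)) := by
    rw [fU]
    simp only [fac_zero, Nat.cast_zero, mul_zero, add_zero]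
    rw [← fac_last f (r-a) (r-a+N) N rfl, ← fac_last f (a+1-b) (a+1-b+N) N rfl,
      ← fac_last f (a+1-c) (a+1-c+N) N rfl, ← fac_last f (a+1-d) (a+1-d+N) N rfl,
      ← fac_last f 1 (N+1) N (by ring), show a+((N+1:ℕ):ℂ)+1 = a+N+2 by push_cast; ring]
    ring
  have f1 : ∀ x, fac f x 1 = f x := by intro x; simp [fac]
  have hH : fH f a b c d r N 0 N = f a * (f b * f c * f d) * fac f (a+N+2) (N+1) * fac f (r-a) N *
      (fac f (a+1-b) N * fac f (a+1-c) N * fac f (a+1-d) N) / fac f 1 N := by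
    rw [fH]
    simp only [fac_zero, f1, Nat.cast_zero, add_zero, zero_add]
    ring
  rw [hU0, hU1, hH]
  generalize f (r+2*N+1) = Z at *
  field_simp
  linear_combination (f a * fac f (a+N+2) (N+1) * fac f (r-a) N * fac f (a+1-b) N *
    fac f (a+1-c) N * fac f (a+1-d) N) * h3

lemma step_succ (f : ℂ → ℂ) (hs : Six f) (a b c d r : ℂ)
    (hr : b+c+d+r = 2*a+1) (N m l : ℕ) (hml : N = m + 1 + l)
    (hN : ∀ k ≤ N+1, fac f 1 k ≠ 0) :
    fU f a b c d r (N+1) (m+1) (l+1) - fρ f a b c d N * fU f a b c d r N (m+1) l =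
      - f (r+2*N+1) / f (N+1) * (fH f a b c d r N (m+1) l - fH f a b c d r N m (l+1)) := by
  have hf : ∀ j : ℕ, j ≤ N → f (j+1) ≠ 0 := by
    intro j hj
    have n2 := hN (j+1) (by omega)
    rw [fac_last f 1 (j+1) j (by ring)] at n2
    exact right_ne_zero_of_mul n2
  obtain ⟨k, hk⟩ : ∃ k, k = m + 1 := ⟨_, rfl⟩
  have hkc : (k:ℂ) = m + 1 := by rw [hk]; push_cast; ring
  have hNc : (N:ℂ) = k + l := by rw [hml, ← hk]; push_cast; ring
  have n1 := hf N le_rfl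
  have n2 : f k ≠ 0 := by rw [hkc]; exact hf m (by omega)
  have n3 := hf l (by omega)
  have n4 := hN m (by omega)
  have n5 := hN l (by omega)
  have e2 : fac f (a+k+N+1) l * (f (a+2*N+1) * f (a+2*N+2)) =
      f (a+k+N+1) * fac f (a+k+N+2) (l+1) := by
    have := fac_first f (a+k+N+1) (a+k+N+2) (l+1) (by ring)
    rw [← this, fac_last f (a+k+N+1) (a+2*N+2) (l+1) (by rw [hNc]; push_cast; ring),
      fac_last f (a+k+N+1) (a+2*N+1) l (by rw [hNc]; ring)]
    ring
  have g1 : fac f 1 k = fac f 1 m * f k := by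
    rw [hk]; exact fac_last f 1 _ m (by push_cast; ring)
  have g2 : fac f 1 (l+1) = fac f 1 l * f (l+1) := fac_last f 1 _ l (by ring)
  have g3 : fac f (r+N+1) k = fac f (r+N+1) m * f (r+N+k) := by
    rw [hk]; exact fac_last f _ _ m (by push_cast; ring)
  have g4 : fac f (r+N) k = f (r+N) * fac f (r+N+1) m := by
    rw [hk]; exact fac_first f _ _ m (by ring)
  have g5 : fac f (r-a) (l+1) = fac f (r-a) l * f (r-a+l) := fac_last f _ _ l rfl
  have g6 : ∀ b, fac f (a+1-b+k) (l+1) = fac f (a+1-b+k) l * f (a+1-b+N) :=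
    fun b => fac_last f _ _ l (by rw [hNc]; ring)
  have g7 : ∀ b, fac f (a+1-b+m) (l+1) = f (a-b+k) * fac f (a+1-b+k) l := by
    intro b
    rw [show a+1-b+(m:ℂ) = a-b+k by rw [hkc]; ring]
    exact fac_first f _ _ l (by ring)
  have g8 : ∀ b, fac f b (k+1) = fac f b k * f (b+k) := fun b => fac_last f b _ k rfl
  rw [← hk]
  have hU0 : fρ f a b c d N * fU f a b c d r N k l =
      f (a+2*k) * fac f a k * (f (a+k+N+1) * fac f (a+k+N+2) (l+1)) *
      (fac f b k * fac f c k * fac f d k) * (f (r+N) * fac f (r+N+1) m) * fac f (r-a) l *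
      (fac f (a+1-b+k) l * fac f (a+1-c+k) l * fac f (a+1-d+k) l) *
      (f (a+1-b-c+N) * f (a+1-b-d+N) * f (a+1-c-d+N)) /
        (fac f 1 m * f k * fac f 1 l * f (N+1)) := by
    rw [← e2, fρ, fU, g4, g1]
    ring
  have hU1 : fU f a b c d r (N+1) k (l+1) =
      f (a+2*k) * fac f a k * fac f (a+k+N+2) (l+1) *
      (fac f b k * fac f c k * fac f d k) * (fac f (r+N+1) m * f (r+N+k)) *
      (fac f (r-a) l * f (r-a+l)) *
      (fac f (a+1-b+k) l * f (a+1-b+N) * (fac f (a+1-c+k) l * f (a+1-c+N)) *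
      (fac f (a+1-d+k) l * f (a+1-d+N))) / (fac f 1 m * f k * (fac f 1 l * f (l+1))) := by
    rw [fU, g6, g6, g6, g5, show r+((N+1:ℕ):ℂ) = r+N+1 by push_cast; ring, g3, g1, g2,
      show a+k+((N+1:ℕ):ℂ)+1 = a+k+N+2 by push_cast; ring]
  have hH1 : fH f a b c d r N k l = fac f a k * f (a+k) *
      (fac f b k * f (b+k) * (fac f c k * f (c+k)) * (fac f d k * f (d+k))) *
      fac f (a+k+N+2) (l+1) * fac f (r-a) l * (fac f (r+N+1) m * f (r+N+k)) *
      (fac f (a+1-b+k) l * fac f (a+1-c+k) l * fac f (a+1-d+k) l) /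
        (fac f 1 m * f k * fac f 1 l) := by
    rw [fH, g8, g8, g8, g8, g3, g1]
  have hH0 : fH f a b c d r N m (l+1) = fac f a k *
      (fac f b k * fac f c k * fac f d k) *
      (f (a+k+N+1) * fac f (a+k+N+2) (l+1)) * (fac f (r-a) l * f (r-a+l)) * fac f (r+N+1) m *
      (f (a-b+k) * fac f (a+1-b+k) l * (f (a-c+k) * fac f (a+1-c+k) l) *
        (f (a-d+k) * fac f (a+1-d+k) l)) /
        (fac f 1 m * (fac f 1 l * f (l+1))) := by
    rw [fH, ← hk, g7, g7, g7, g5, g2, show a+m+N+2 = a+k+N+1 by rw [hkc]; ring,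
      fac_first f (a+k+N+1) (a+k+N+2) (l+1) (by ring)]
  have h6 := six_spec f hs a b c d r k l N hr hNc
  rw [hU0, hU1, hH1, hH0]
  generalize fac f a k = A at *
  generalize fac f b k = B at *
  generalize fac f c k = C at *
  generalize fac f d k = D at *
  generalize fac f (a+k+N+2) (l+1) = Q at *
  generalize fac f (r-a) l = S at *
  generalize fac f (r+N+1) m = R at *
  generalize fac f (a+1-b+k) l = Tb at *
  generalize fac f (a+1-c+k) l = Tc at *
  generalize fac f (a+1-d+k) l = Td at *
  generalize fac f 1 m = F at *
  generalize fac f 1 l = G at *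
  clear e2 g1 g2 g3 g4 g5 g6 g7 g8 hU0 hU1 hH1 hH0 hf hN
  rw [← sub_eq_zero]
  trans (A*B*C*D*Q*S*R*Tb*Tc*Td/(F*G*f k*f (l+1)*f (N+1))) * (f (r+2*N+1) * (f (a+k) * f (b+k) * f (c+k) * f (d+k) * f (r+N+k) * f (l+1)
      - f k * f (a-b+k) * f (a-c+k) * f (a-d+k) * f (r-a+l) * f (a+k+N+1)) +
    f (a+2*k) * (f (r+N+k) * f (r-a+l) *
        (f (N+1) * f (a+1-b+N) * f (a+1-c+N) * f (a+1-d+N)) -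
      f (l+1) * f (a+k+N+1) *
        (f (r+N) * f (a+1-c-d+N) * f (a+1-b-d+N) * f (a+1-b-c+N))))
  · field_simp
    ring
  · rw [h6, mul_zero]

lemma sum_cleared (f : ℂ → ℂ) (hodd : ∀ x, f (-x) = - f x) (ht : Tri f) (hs : Six f)
    (a b c d r : ℂ) (hr : b+c+d+r = 2*a+1) (N : ℕ) (hN : ∀ k ≤ N, fac f 1 k ≠ 0) :
    ∑ k ∈ Finset.range (N+1), fU f a b c d r N k (N-k) =
      fac f a (2*N+1) * (fac f (a+1-b-c) N * fac f (a+1-b-d) N * fac f (a+1-c-d) N) /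
        fac f 1 N := by
  induction N with
  | zero => simp [fU, fac]
  | succ N ih =>
    have ih := ih (fun k hk => hN k (by omega))
    have part : ∀ m ≤ N, ∑ k ∈ Finset.range (m+1), (fU f a b c d r (N+1) k (N+1-k) -
        fρ f a b c d N * fU f a b c d r N k (N-k)) =
        - f (r+2*N+1) / f (N+1) * fH f a b c d r N m (N-m) := by
      intro m
      induction m with
      | zero =>
        intro _
        rw [Finset.sum_range_one]
        exact step_zero f hodd ht a b c d r hr N hN
      | succ m ihm =>
        intro hm
        rw [Finset.sum_range_succ, ihm (by omega)]
        obtain ⟨l, hl⟩ : ∃ l, N = m + 1 + l := ⟨N - (m+1), by omega⟩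
        have := step_succ f hs a b c d r hr N m l hl hN
        rw [show N - m = l+1 by omega, show N + 1 - (m+1) = l + 1 by omega,
          show N - (m+1) = l by omega, this]
        ring
    have hp := part N le_rfl
    rw [Finset.sum_sub_distrib, ← Finset.mul_sum, ih, Nat.sub_self] at hp
    rw [Finset.sum_range_succ, Nat.sub_self]
    have n1 := hN N (by omega)
    have n2 := hN (N+1) le_rfl
    have g1 : fac f 1 (N+1) = fac f 1 N * f (N+1) := fac_last f 1 _ N (by ring)
    rw [g1] at n2
    have n3 := right_ne_zero_of_mul n2
    have hlast : fU f a b c d r (N+1) (N+1) 0 =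
        f (r+2*N+1) / f (N+1) * fH f a b c d r N N 0 := by
      rw [fU, fH, g1]
      rw [fac_last f (r+((N+1:ℕ):ℂ)) (r+2*N+1) N (by push_cast; ring)]
      rw [fac_last f (a+N+N+2) (a+2*((N+1:ℕ):ℂ)) 0 (by push_cast; ring)]
      simp only [fac_zero]
      rw [show r+((N+1:ℕ):ℂ) = r+N+1 by push_cast; ring]
      field_simp
    have hρ : fρ f a b c d N * (fac f a (2*N+1) * (fac f (a+1-b-c) N * fac f (a+1-b-d) N *
        fac f (a+1-c-d) N) / fac f 1 N) = fac f a (2*(N+1)+1) * (fac f (a+1-b-c) (N+1) *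
        fac f (a+1-b-d) (N+1) * fac f (a+1-c-d) (N+1)) / fac f 1 (N+1) := by
      rw [g1, show 2*(N+1)+1 = 2*N+1+1+1 by ring,
        fac_last f a (a+2*N+2) (2*N+1+1) (by push_cast; ring),
        fac_last f a (a+2*N+1) (2*N+1) (by push_cast; ring),
        fac_last f (a+1-b-c) _ N rfl, fac_last f (a+1-b-d) _ N rfl, fac_last f (a+1-c-d) _ N rfl, fρ]
      field_simp
    rw [← hρ, hlast]
    linear_combination hp

lemma ft_abstract (f : ℂ → ℂ) (hodd : ∀ x, f (-x) = - f x) (ht : Tri f) (hs : Six f)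
    (N : ℕ) (a b c d e : ℂ)
    (hbal : b + c + d + e = 2*a + N + 1)
    (ha : f a ≠ 0)
    (h1 : ∀ k ≤ N, fac f 1 k ≠ 0)
    (h2 : ∀ k ≤ N, fac f (a + 1 - b) k ≠ 0)
    (h3 : ∀ k ≤ N, fac f (a + 1 - c) k ≠ 0)
    (h4 : ∀ k ≤ N, fac f (a + 1 - d) k ≠ 0)
    (h5 : ∀ k ≤ N, fac f (a + 1 - e) k ≠ 0)
    (h6 : ∀ k ≤ N, fac f (a + 1 + N) k ≠ 0)
    (h7 : fac f (a + 1 - b - c - d) N ≠ 0) :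
    (∑ k ∈ Finset.range (N + 1),
      (f (a + 2*k) / f a) *
        (fac f a k * fac f b k * fac f c k * fac f d k *
          fac f e k * fac f (-(N : ℂ)) k) /
        (fac f 1 k * fac f (a + 1 - b) k * fac f (a + 1 - c) k *
          fac f (a + 1 - d) k * fac f (a + 1 - e) k *
          fac f (a + 1 + N) k))
    = (fac f (a + 1) N * fac f (a + 1 - b - c) N *
        fac f (a + 1 - b - d) N * fac f (a + 1 - c - d) N) /
      (fac f (a + 1 - b) N * fac f (a + 1 - c) N *
        fac f (a + 1 - d) N * fac f (a + 1 - b - c - d) N) := by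
  obtain ⟨r, hr⟩ : ∃ r, r = 2*a+1-b-c-d := ⟨_, rfl⟩
  have he : e = r + N := by rw [hr]; linear_combination hbal
  have hra : a+1-b-c-d = r-a := by rw [hr]; ring
  have S := sum_cleared f hodd ht hs a b c d r (by rw [hr]; ring) N h1
  rw [hra] at h7 ⊢
  have q1 := h1 N le_rfl
  have q2 := h2 N le_rfl
  have q3 := h3 N le_rfl
  have q4 := h4 N le_rfl
  have q6 := h6 N le_rfl
  have term : ∀ k ∈ Finset.range (N+1), (f (a + 2*k) / f a) *
        (fac f a k * fac f b k * fac f c k * fac f d k *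
          fac f e k * fac f (-(N : ℂ)) k) /
        (fac f 1 k * fac f (a + 1 - b) k * fac f (a + 1 - c) k *
          fac f (a + 1 - d) k * fac f (a + 1 - e) k *
          fac f (a + 1 + N) k) = fac f 1 N / (f a * fac f (a+1+N) N * fac f (a+1-b) N *
          fac f (a+1-c) N * fac f (a+1-d) N * fac f (r-a) N) * fU f a b c d r N k (N-k) := by
    intro k hk
    have hk' : k ≤ N := by
      have := Finset.mem_range.1 hk
      omega
    obtain ⟨l, hl⟩ : ∃ l, N = k + l := ⟨N - k, by omega⟩
    rw [show N - k = l by omega]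
    have u1 := h1 k hk'
    have u2 := h2 k hk'
    have u3 := h3 k hk'
    have u4 := h4 k hk'
    have u5 := h5 k hk'
    have u6 := h6 k hk'
    have ul := h1 l (by omega)
    have s6 := fac_split f (a+1+N) (a+k+N+1) N k l hl (by ring)
    have s2 := fac_split f (a+1-b) (a+1-b+k) N k l hl rfl
    have s3 := fac_split f (a+1-c) (a+1-c+k) N k l hl rfl
    have s4 := fac_split f (a+1-d) (a+1-d+k) N k l hl rfl
    have r1 := fac_refl f hodd (r-a) N k l hl
    have r2 := fac_refl f hodd 1 N k l hl
    rw [show 1-(r-a)-N = a+1-e by rw [he]; ring] at r1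
    rw [show (1:ℂ)-1-N = -N by ring] at r2
    have hε : ((-1:ℂ)^k) * (-1)^k = 1 := by rw [← mul_pow]; simp
    have r1' : fac f (r-a) N = (-1)^k * (fac f (a+1-e) k * fac f (r-a) l) := by
      rw [r1, ← mul_assoc, hε, one_mul]
    have r2' : fac f 1 N = (-1)^k * (fac f (-N) k * fac f 1 l) := by
      rw [r2, ← mul_assoc, hε, one_mul]
    have hε0 : ((-1:ℂ)^k) ≠ 0 := left_ne_zero_of_mul (hε ▸ one_ne_zero)
    rw [s2] at q2
    rw [s3] at q3
    rw [s4] at q4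
    rw [s6] at q6
    rw [r1'] at h7
    rw [fU, s2, s3, s4, s6, r1', r2', ← he]
    have v2 := right_ne_zero_of_mul q2
    have v3 := right_ne_zero_of_mul q3
    have v4 := right_ne_zero_of_mul q4
    have v6 := right_ne_zero_of_mul q6
    have v7 := right_ne_zero_of_mul (right_ne_zero_of_mul h7)
    generalize (-1:ℂ)^k = ε at *
    field_simp
  rw [Finset.sum_congr rfl term, ← Finset.mul_sum, S, show 2*N+1 = (N+N)+1 by ring,
    fac_first f a (a+1) (N+N) rfl, fac_split f (a+1) (a+1+N) (N+N) N N rfl rfl]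
  field_simp
/-- The Frenkel–Turaev summation formula for elliptic hypergeometric
series, under the balancing condition b+c+d+e = 2a+N+1. -/
theorem frenkel_turaev_summation
    (t : ℝ) (ht : 0 < t) (τ : ℂ) (hτ : τ = t * I)
    (N : ℕ) (η : ℂ) (a b c d e : ℂ)
    (hbal : b + c + d + e = 2*a + N + 1)
    (ha : ell τ η a ≠ 0)
    (h1 : ∀ k ≤ N, ellFac τ η 1 k ≠ 0)
    (h2 : ∀ k ≤ N, ellFac τ η (a + 1 - b) k ≠ 0)
    (h3 : ∀ k ≤ N, ellFac τ η (a + 1 - c) k ≠ 0)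
    (h4 : ∀ k ≤ N, ellFac τ η (a + 1 - d) k ≠ 0)
    (h5 : ∀ k ≤ N, ellFac τ η (a + 1 - e) k ≠ 0)
    (h6 : ∀ k ≤ N, ellFac τ η (a + 1 + N) k ≠ 0)
    (h7 : ellFac τ η (a + 1 - b - c - d) N ≠ 0) :
    (∑ k ∈ Finset.range (N + 1),
      (ell τ η (a + 2*k) / ell τ η a) *
        (ellFac τ η a k * ellFac τ η b k * ellFac τ η c k * ellFac τ η d k *
          ellFac τ η e k * ellFac τ η (-(N : ℂ)) k) /
        (ellFac τ η 1 k * ellFac τ η (a + 1 - b) k * ellFac τ η (a + 1 - c) k *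
          ellFac τ η (a + 1 - d) k * ellFac τ η (a + 1 - e) k *
          ellFac τ η (a + 1 + N) k))
    = (ellFac τ η (a + 1) N * ellFac τ η (a + 1 - b - c) N *
        ellFac τ η (a + 1 - b - d) N * ellFac τ η (a + 1 - c - d) N) /
      (ellFac τ η (a + 1 - b) N * ellFac τ η (a + 1 - c) N *
        ellFac τ η (a + 1 - d) N * ellFac τ η (a + 1 - b - c - d) N) := by
  have him : 0 < τ.im := by rw [hτ]; simpa using ht
  refine ft_abstract (ell τ η) ?_ ?_ ?_ N a b c d e hbal ha h1 h2 h3 h4 h5 h6 h7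
  · intro x
    rw [ell, ell, ← θf_odd him]
    congr 1; ring
  · intro p q r b c s hs
    have h := θf_tri him (2*η*p) (2*η*q) (2*η*r) (2*η*b) (2*η*c) (2*η*s) (by rw [hs]; ring)
    simp only [ell, mul_add, mul_sub] at h ⊢
    exact h
  · intro x L M b₁ b₂ b₃ b₄ hs
    have h := θf_six him (2*η*x) (2*η*L) (2*η*M) (2*η*b₁) (2*η*b₂) (2*η*b₃) (2*η*b₄)
      (by linear_combination (2*η) * hs)
    rw [show 2*(2*η*x) = 2*η*(2*x) by ring] at h
    simp only [ell, mul_add, mul_sub] at h ⊢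
    exact h
end
end
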